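/- arXiv:q-alg/9511014 — 2 statements merged into one kernel-verified Lean document; each statement's English description precedes it below -/
import Mathlib

section
/- Let l ≥ 1 be an integer and q a nonzero complex number with q² ≠ 1. The explicit matrices U, V, W of the spin-(l/2) construction satisfy the almost-representation relations of the braided Lie algebra sl(2)_q: q²UV − VU = −θU, (q³+q)(UW − WU) + (1−q²)V² = θV, and −q²VW + WV = θW, where θ = q^{2l+1} + q^{−1}. -/
open Matrix

noncomputable section

/-- The q-number `b_n = (q^n - q^{-n})/(q - q⁻¹)`. -/
def bq (q : ℂ) (n : ℤ) : ℂ := (q ^ n - q ^ (-n)) / (q - q⁻¹)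

/-- `y_i = b_i * b_{l+1-i}`. -/
def yq (l : ℕ) (q : ℂ) (i : ℕ) : ℂ := bq q (i : ℤ) * bq q ((l : ℤ) + 1 - (i : ℤ))

/-- The superdiagonal matrix of 1's: `X̂ e_{j+1} = e_j`. -/
def Xh (l : ℕ) : Matrix (Fin (l + 1)) (Fin (l + 1)) ℂ :=
  Matrix.of fun i j => if (j : ℕ) = (i : ℕ) + 1 then 1 else 0

/-- `Ĥ = diag(l, l-2, …, -l)`. -/
def Hh (l : ℕ) : Matrix (Fin (l + 1)) (Fin (l + 1)) ℂ :=
  Matrix.diagonal fun i => (l : ℂ) - 2 * ((i : ℕ) : ℂ)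

/-- `K = diag(q^l, q^{l-2}, …, q^{-l})`. -/
def Kh (l : ℕ) (q : ℂ) : Matrix (Fin (l + 1)) (Fin (l + 1)) ℂ :=
  Matrix.diagonal fun i => q ^ ((l : ℤ) - 2 * ((i : ℕ) : ℤ))

/-- `K⁻¹ = diag(q^{-l}, q^{2-l}, …, q^l)`. -/
def Khinv (l : ℕ) (q : ℂ) : Matrix (Fin (l + 1)) (Fin (l + 1)) ℂ :=
  Matrix.diagonal fun i => q ^ (2 * ((i : ℕ) : ℤ) - (l : ℤ))

/-- `Ŷ e_j = y_j e_{j+1}`. -/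
def Yh (l : ℕ) (q : ℂ) : Matrix (Fin (l + 1)) (Fin (l + 1)) ℂ :=
  Matrix.of fun i j => if (i : ℕ) = (j : ℕ) + 1 then yq l q ((j : ℕ) + 1) else 0

/-- Adjoint action of `X`: `ρ_End(X)M = X̂M − K⁻¹MKX̂`. -/
def rhoX (l : ℕ) (q : ℂ) (M : Matrix (Fin (l + 1)) (Fin (l + 1)) ℂ) :
    Matrix (Fin (l + 1)) (Fin (l + 1)) ℂ :=
  Xh l * M - Khinv l q * M * Kh l q * Xh l

/-- Adjoint action of `H`: `ρ_End(H)M = ĤM − MĤ`. -/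
def rhoH (l : ℕ) (M : Matrix (Fin (l + 1)) (Fin (l + 1)) ℂ) :
    Matrix (Fin (l + 1)) (Fin (l + 1)) ℂ :=
  Hh l * M - M * Hh l

/-- Adjoint action of `Y`: `ρ_End(Y)M = (ŶM − MŶ)K⁻¹`. -/
def rhoY (l : ℕ) (q : ℂ) (M : Matrix (Fin (l + 1)) (Fin (l + 1)) ℂ) :
    Matrix (Fin (l + 1)) (Fin (l + 1)) ℂ :=
  (Yh l q * M - M * Yh l q) * Khinv l q

/-- The superdiagonal matrix `U` with entries `(q^{2(l-1)}, …, q², 1)`. -/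
def Um (l : ℕ) (q : ℂ) : Matrix (Fin (l + 1)) (Fin (l + 1)) ℂ :=
  Matrix.of fun i j =>
    if (j : ℕ) = (i : ℕ) + 1 then q ^ (2 * ((l : ℤ) - 1 - ((i : ℕ) : ℤ))) else 0

/-- `V = −ρ_End(Y)U`. -/
def Vm (l : ℕ) (q : ℂ) : Matrix (Fin (l + 1)) (Fin (l + 1)) ℂ := -(rhoY l q (Um l q))

/-- `W = (q + q⁻¹)⁻¹ ρ_End(Y)V`. -/
def Wm (l : ℕ) (q : ℂ) : Matrix (Fin (l + 1)) (Fin (l + 1)) ℂ :=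
  (q + q⁻¹)⁻¹ • rhoY l q (Vm l q)

/-- The eigenvalue of `V` on the `i`-th basis vector (counting from `0`). -/
def vEntry (l : ℕ) (q : ℂ) (i : ℕ) : ℂ :=
  (q ^ (2 * (l : ℤ) + 1) + q⁻¹ - q ^ (2 * (l : ℤ) - 2 * (i : ℤ) - 1) * (1 + q ^ 2)) / (1 - q ^ 2)

lemma bq_zero (q : ℂ) : bq q 0 = 0 := by simp [bq]

lemma yq_zero (l : ℕ) (q : ℂ) : yq l q 0 = 0 := by simp [yq, bq_zero]

lemma yq_length_add_one (l : ℕ) (q : ℂ) : yq l q (l + 1) = 0 := by simp [yq, bq_zero]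

lemma Um_mul_Yh (l : ℕ) (q : ℂ) :
    Um l q * Yh l q = diagonal fun i : Fin (l + 1) =>
      q ^ (2 * ((l : ℤ) - 1 - ((i : ℕ) : ℤ))) * yq l q ((i : ℕ) + 1) := by
  ext i j
  rw [Matrix.mul_apply]
  by_cases hi : (i : ℕ) = l
  · have hy : yq l q ((i : ℕ) + 1) = 0 := by rw [hi, yq_length_add_one]
    rw [Finset.sum_eq_zero fun k _ => ?_]
    · simp [diagonal_apply, hy]
    · have : (k : ℕ) ≠ (i : ℕ) + 1 := by omega
      simp [Um, this]
  · rw [Finset.sum_eq_single ⟨(i : ℕ) + 1, by omega⟩]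
    · rcases eq_or_ne i j with rfl | hij
      · simp [Um, Yh]
      · have : (i : ℕ) ≠ j := fun h => hij (Fin.ext h)
        simp [Um, Yh, hij, this]
    · intro k _ hk
      have : (k : ℕ) ≠ (i : ℕ) + 1 := fun h => hk (Fin.ext h)
      simp [Um, this]
    · simp

lemma Yh_mul_Um (l : ℕ) (q : ℂ) :
    Yh l q * Um l q = diagonal fun i : Fin (l + 1) =>
      yq l q (i : ℕ) * q ^ (2 * ((l : ℤ) - ((i : ℕ) : ℤ))) := by
  ext i j
  rw [Matrix.mul_apply]
  by_cases hi : (i : ℕ) = 0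
  · have hy : yq l q (i : ℕ) = 0 := by rw [hi, yq_zero]
    rw [Finset.sum_eq_zero fun k _ => ?_]
    · simp [diagonal_apply, hy]
    · simp [Yh, hi]
  · obtain ⟨n, hn⟩ := Nat.exists_eq_add_one_of_ne_zero hi
    rw [Finset.sum_eq_single ⟨n, by omega⟩]
    · rcases eq_or_ne i j with rfl | hij
      · have : (l : ℤ) - 1 - n = l - (n + 1) := by ring
        simp [Um, Yh, hn, this]
      · have : (j : ℕ) ≠ n + 1 := fun h => hij (Fin.ext (hn.trans h.symm))
        simp [Um, Yh, hij, this]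
    · intro k _ hk
      have : (i : ℕ) ≠ (k : ℕ) + 1 := fun h => hk (Fin.ext (by simp only; omega))
      simp [Yh, this]
    · simp

section Relations

variable (l : ℕ) {q : ℂ}

lemma one_sub_sq_mul_vEntry (hq2 : q ^ 2 ≠ 1) (i : ℕ) :
    (1 - q ^ 2) * vEntry l q i =
      q ^ (2 * (l : ℤ) + 1) + q⁻¹ - q ^ (2 * (l : ℤ) - 2 * (i : ℤ) - 1) * (1 + q ^ 2) :=
  mul_div_cancel₀ _ (sub_ne_zero.mpr hq2.symm)

lemma vEntry_recurrence (hq : q ≠ 0) (hq2 : q ^ 2 ≠ 1) (i : ℕ) :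
    vEntry l q i - q ^ 2 * vEntry l q (i + 1) = q ^ (2 * (l : ℤ) + 1) + q⁻¹ := by
  have hne : (1 - q ^ 2) ≠ 0 := sub_ne_zero.mpr hq2.symm
  apply mul_left_cancel₀ hne
  have h0 := one_sub_sq_mul_vEntry l hq2 i
  have h1 := one_sub_sq_mul_vEntry l hq2 (i + 1)
  have hs : q ^ (2 * (l : ℤ) - 2 * (i : ℤ) - 1) =
      q ^ 2 * q ^ (2 * (l : ℤ) - 2 * ((i + 1 : ℕ) : ℤ) - 1) := by
    rw [← zpow_natCast, ← zpow_add₀ hq]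
    congr 1
    push_cast
    ring
  rw [hs] at h0
  linear_combination h0 - q ^ 2 * h1

lemma vEntry_sub_vEntry_succ (hq : q ≠ 0) (hq2 : q ^ 2 ≠ 1) (i : ℕ) :
    (vEntry l q i - vEntry l q (i + 1)) * q ^ (2 * (i : ℤ) - (l : ℤ)) =
      (q + q⁻¹) * q ^ ((l : ℤ) - 2) := by
  have hne : (1 - q ^ 2) ≠ 0 := sub_ne_zero.mpr hq2.symm
  apply mul_left_cancel₀ hne
  have h0 := one_sub_sq_mul_vEntry l hq2 i
  have h1 := one_sub_sq_mul_vEntry l hq2 (i + 1)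
  rw [← mul_assoc, mul_sub, h0, h1]
  have e0 : q ^ (2 * (l : ℤ) - 2 * (i : ℤ) - 1) * q ^ (2 * (i : ℤ) - (l : ℤ)) =
      q * q ^ ((l : ℤ) - 2) := by
    rw [← zpow_add₀ hq, ← zpow_one_add₀ hq]
    congr 1
    ring
  have e1 : q ^ (2 * (l : ℤ) - 2 * ((i + 1 : ℕ) : ℤ) - 1) * q ^ (2 * (i : ℤ) - (l : ℤ)) =
      q⁻¹ * q ^ ((l : ℤ) - 2) := by
    rw [← zpow_add₀ hq, ← _root_.zpow_neg_one, ← zpow_add₀ hq]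
    congr 1
    push_cast
    ring
  have e2 : q * q⁻¹ = 1 := mul_inv_cancel₀ hq
  linear_combination (1 + q ^ 2) * e1 - (1 + q ^ 2) * e0 +
    (2 * q * q ^ ((l : ℤ) - 2)) * e2

lemma commutator_entry (hq : q ≠ 0) (hq2 : q ^ 2 ≠ 1) (i : ℕ) :
    q ^ (2 * ((l : ℤ) - 1 - (i : ℤ))) * yq l q (i + 1) -
        yq l q i * q ^ (2 * ((l : ℤ) - (i : ℤ))) =
      vEntry l q i * q ^ ((l : ℤ) - 2 * (i : ℤ)) := by
  have hne : (1 - q ^ 2) ≠ 0 := sub_ne_zero.mpr hq2.symm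
  have hne' : q ^ 2 - 1 ≠ 0 := sub_ne_zero.mpr hq2
  have hd : q - q⁻¹ = (q ^ 2 - 1) / q := by field_simp
  simp only [yq, bq, vEntry, hd]
  push_cast
  have ha : q ^ (l : ℤ) ≠ 0 := zpow_ne_zero _ hq
  have hb : q ^ (i : ℤ) ≠ 0 := zpow_ne_zero _ hq
  simp only [zpow_add₀ hq, zpow_sub₀ hq, _root_.zpow_neg, _root_.zpow_mul', zpow_ofNat]
  generalize q ^ (l : ℤ) = a at *
  generalize q ^ (i : ℤ) = b at *
  field_simp
  ring

lemma Kh_mul_Khinv (hq : q ≠ 0) : Kh l q * Khinv l q = 1 := by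
  rw [Kh, Khinv, diagonal_mul_diagonal, ← diagonal_one]
  congr 1
  ext i
  rw [← zpow_add₀ hq]
  simp

lemma Um_Yh_commutator (hq : q ≠ 0) (hq2 : q ^ 2 ≠ 1) :
    Um l q * Yh l q - Yh l q * Um l q =
      diagonal (fun i : Fin (l + 1) => vEntry l q i) * Kh l q := by
  rw [Um_mul_Yh, Yh_mul_Um, Kh, diagonal_sub, diagonal_mul_diagonal]
  congr 1
  ext i
  exact commutator_entry l hq hq2 i

lemma Vm_eq_diagonal (hq : q ≠ 0) (hq2 : q ^ 2 ≠ 1) :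
    Vm l q = diagonal fun i : Fin (l + 1) => vEntry l q i := by
  rw [Vm, rhoY, ← neg_mul, neg_sub, Um_Yh_commutator l hq hq2, Matrix.mul_assoc,
    Kh_mul_Khinv l hq, Matrix.mul_one]

lemma rhoY_Vm (hq : q ≠ 0) (hq2 : q ^ 2 ≠ 1) :
    rhoY l q (Vm l q) = ((q + q⁻¹) * q ^ ((l : ℤ) - 2)) • Yh l q := by
  ext i j
  rw [rhoY, Vm_eq_diagonal l hq hq2, Khinv, mul_diagonal, Matrix.sub_apply, mul_diagonal,
    diagonal_mul, Matrix.smul_apply, smul_eq_mul]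
  by_cases h : (i : ℕ) = (j : ℕ) + 1
  · rw [← vEntry_sub_vEntry_succ l hq hq2 j, h]
    ring
  · simp [Yh, h]

lemma Wm_eq_smul_Yh (hq : q ≠ 0) (hq2 : q ^ 2 ≠ 1) :
    Wm l q = ((q + q⁻¹)⁻¹ * ((q + q⁻¹) * q ^ ((l : ℤ) - 2))) • Yh l q := by
  rw [Wm, rhoY_Vm l hq hq2, smul_smul]

lemma sq_smul_Um_mul_Vm_sub (hq : q ≠ 0) (hq2 : q ^ 2 ≠ 1) :
    q ^ 2 • (Um l q * Vm l q) - Vm l q * Um l q =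
      (-(q ^ (2 * (l : ℤ) + 1) + q⁻¹)) • Um l q := by
  ext i j
  rw [Vm_eq_diagonal l hq hq2, Matrix.sub_apply, Matrix.smul_apply, mul_diagonal, diagonal_mul,
    Matrix.smul_apply, smul_eq_mul, smul_eq_mul]
  by_cases h : (j : ℕ) = (i : ℕ) + 1
  · rw [← vEntry_recurrence l hq hq2 i, h]
    ring
  · simp [Um, h]

lemma neg_sq_smul_Vm_mul_Yh_add (hq : q ≠ 0) (hq2 : q ^ 2 ≠ 1) :
    (-q ^ 2) • (Vm l q * Yh l q) + Yh l q * Vm l q =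
      (q ^ (2 * (l : ℤ) + 1) + q⁻¹) • Yh l q := by
  ext i j
  rw [Vm_eq_diagonal l hq hq2, Matrix.add_apply, Matrix.smul_apply, mul_diagonal, diagonal_mul,
    Matrix.smul_apply, smul_eq_mul, smul_eq_mul]
  by_cases h : (i : ℕ) = (j : ℕ) + 1
  · rw [← vEntry_recurrence l hq hq2 j, h]
    ring
  · simp [Yh, h]

/-- The scalar `(q³ + q) (q + q⁻¹)⁻¹ (q + q⁻¹)` is `q³ + q` even when `q + q⁻¹ = 0`. -/
lemma cube_add_self_mul_cancel (hq : q ≠ 0) :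
    (q ^ 3 + q) * ((q + q⁻¹)⁻¹ * (q + q⁻¹)) = q ^ 3 + q := by
  have h : q ^ 3 + q = q ^ 2 * (q + q⁻¹) := by field_simp
  rw [h, mul_assoc, ← mul_assoc (q + q⁻¹), mul_inv_mul_cancel]

lemma Um_Wm_commutator_relation (hq : q ≠ 0) (hq2 : q ^ 2 ≠ 1) :
    (q ^ 3 + q) • (Um l q * Wm l q - Wm l q * Um l q) + (1 - q ^ 2) • (Vm l q * Vm l q) =
      (q ^ (2 * (l : ℤ) + 1) + q⁻¹) • Vm l q := by
  have hc : (q ^ 3 + q) * ((q + q⁻¹)⁻¹ * ((q + q⁻¹) * q ^ ((l : ℤ) - 2))) =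
      (q ^ 3 + q) * q ^ ((l : ℤ) - 2) := by
    rw [← mul_assoc _ (q + q⁻¹), ← mul_assoc (q ^ 3 + q), cube_add_self_mul_cancel hq]
  rw [Wm_eq_smul_Yh l hq hq2, mul_smul_comm, smul_mul_assoc, ← smul_sub, smul_smul, hc,
    Um_Yh_commutator l hq hq2, Vm_eq_diagonal l hq hq2, Kh, diagonal_mul_diagonal,
    diagonal_mul_diagonal, ← diagonal_smul, ← diagonal_smul, ← diagonal_smul, diagonal_add]
  congr 1
  ext i
  simp only [Pi.smul_apply, smul_eq_mul]
  have hz : q * q ^ ((l : ℤ) - 2) * q ^ ((l : ℤ) - 2 * ((i : ℕ) : ℤ)) =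
      q ^ (2 * (l : ℤ) - 2 * ((i : ℕ) : ℤ) - 1) := by
    rw [← zpow_one_add₀ hq, ← zpow_add₀ hq]
    congr 1
    ring
  linear_combination vEntry l q i * one_sub_sq_mul_vEntry l hq2 i +
    (1 + q ^ 2) * vEntry l q i * hz

lemma neg_sq_smul_Vm_mul_Wm_add (hq : q ≠ 0) (hq2 : q ^ 2 ≠ 1) :
    (-q ^ 2) • (Vm l q * Wm l q) + Wm l q * Vm l q =
      (q ^ (2 * (l : ℤ) + 1) + q⁻¹) • Wm l q := by
  rw [Wm_eq_smul_Yh l hq hq2, mul_smul_comm, smul_mul_assoc, smul_comm (-q ^ 2), ← smul_add,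
    neg_sq_smul_Vm_mul_Yh_add l hq hq2, smul_comm]

end Relations

/-- the matrices `U, V, W` of the spin-(l/2) construction satisfy the
almost-representation relations of the braided Lie algebra `sl(2)_q`,
with `θ = q^{2l+1} + q⁻¹`. -/
theorem almost_representation_relations (l : ℕ) (hl : 1 ≤ l) (q : ℂ) (hq : q ≠ 0)
    (hq2 : q ^ 2 ≠ 1) :
    q ^ 2 • (Um l q * Vm l q) - Vm l q * Um l q
        = (-(q ^ (2 * (l : ℤ) + 1) + q⁻¹)) • Um l q ∧
    (q ^ 3 + q) • (Um l q * Wm l q - Wm l q * Um l q) + (1 - q ^ 2) • (Vm l q * Vm l q)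
        = (q ^ (2 * (l : ℤ) + 1) + q⁻¹) • Vm l q ∧
    (-q ^ 2) • (Vm l q * Wm l q) + Wm l q * Vm l q
        = (q ^ (2 * (l : ℤ) + 1) + q⁻¹) • Wm l q := by
  exact ⟨sq_smul_Um_mul_Vm_sub l hq hq2, Um_Wm_commutator_relation l hq hq2,
    neg_sq_smul_Vm_mul_Wm_add l hq hq2⟩
end
end

section
/- Let q be a nonzero real number and h, c arbitrary scalars. The linear map φ : V⊗V → V ⊕ k (k the 1-dimensional trivial module) defined by φ = 0 on V₂, φ(q²u⊗v − v⊗u) = −2hu, φ((q³+q)(u⊗w − w⊗u) + (1−q²)v⊗v) = 2hv, φ(−q²v⊗w + w⊗v) = 2hw, and φ((q³+q)u⊗w + v⊗v + (q+q^{−1})w⊗u) = c, intertwines the U_q(sl(2))-actions: φ∘X₂ = (X̂⊕0)∘φ, φ∘Y₂ = (Ŷ⊕0)∘φ, and φ∘H₂ = (Ĥ⊕0)∘φ, where X, Y, H act on V⊕k by X̂, Ŷ, Ĥ on the V-summand and by zero on the k-summand. -/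
open Matrix TensorProduct

noncomputable section

/-- The 3-dimensional module `V` with basis `{u, v, w}`. -/
abbrev V3 : Type := Fin 3 → ℝ

def uB : V3 := ![1, 0, 0]
def vB : V3 := ![0, 1, 0]
def wB : V3 := ![0, 0, 1]

/-- `X̂u = 0, X̂v = −(q+q⁻¹)u, X̂w = v`. -/
def Xop (q : ℝ) : V3 →ₗ[ℝ] V3 :=
  Matrix.toLin' !![0, -(q + q⁻¹), 0; 0, 0, 1; 0, 0, 0]

/-- `Ŷu = −v, Ŷv = (q+q⁻¹)w, Ŷw = 0`. -/
def Yop (q : ℝ) : V3 →ₗ[ℝ] V3 :=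
  Matrix.toLin' !![0, 0, 0; -1, 0, 0; 0, q + q⁻¹, 0]

/-- `Ĥu = 2u, Ĥv = 0, Ĥw = −2w`. -/
def Hop : V3 →ₗ[ℝ] V3 := Matrix.toLin' (Matrix.diagonal ![2, 0, -2])

/-- `Ku = q²u, Kv = v, Kw = q⁻²w`. -/
def Kop (q : ℝ) : V3 →ₗ[ℝ] V3 := Matrix.toLin' (Matrix.diagonal ![q ^ 2, 1, (q ^ 2)⁻¹])

/-- `K⁻¹u = q⁻²u, K⁻¹v = v, K⁻¹w = q²w`. -/
def Kinvop (q : ℝ) : V3 →ₗ[ℝ] V3 := Matrix.toLin' (Matrix.diagonal ![(q ^ 2)⁻¹, 1, q ^ 2])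

/-- `X₂ = X̂⊗1 + K⁻¹⊗X̂` acting on `V⊗V`. -/
def X2 (q : ℝ) : V3 ⊗[ℝ] V3 →ₗ[ℝ] V3 ⊗[ℝ] V3 :=
  TensorProduct.map (Xop q) LinearMap.id + TensorProduct.map (Kinvop q) (Xop q)

/-- `Y₂ = 1⊗Ŷ + Ŷ⊗K` acting on `V⊗V`. -/
def Y2 (q : ℝ) : V3 ⊗[ℝ] V3 →ₗ[ℝ] V3 ⊗[ℝ] V3 :=
  TensorProduct.map LinearMap.id (Yop q) + TensorProduct.map (Yop q) (Kop q)

/-- `H₂ = Ĥ⊗1 + 1⊗Ĥ` acting on `V⊗V`. -/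
def H2 : V3 ⊗[ℝ] V3 →ₗ[ℝ] V3 ⊗[ℝ] V3 :=
  TensorProduct.map Hop LinearMap.id + TensorProduct.map LinearMap.id Hop

/-- The spin-0 generator `(q³+q)u⊗w + v⊗v + (q+q⁻¹)w⊗u`. -/
def g0 (q : ℝ) : V3 ⊗[ℝ] V3 :=
  (q ^ 3 + q) • (uB ⊗ₜ[ℝ] wB) + vB ⊗ₜ[ℝ] vB + (q + q⁻¹) • (wB ⊗ₜ[ℝ] uB)

/-- The spin-1 generator `q²u⊗v − v⊗u`. -/
def g1 (q : ℝ) : V3 ⊗[ℝ] V3 := q ^ 2 • (uB ⊗ₜ[ℝ] vB) - vB ⊗ₜ[ℝ] uB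

/-- The spin-1 generator `(q³+q)(u⊗w − w⊗u) + (1−q²)v⊗v`. -/
def g2 (q : ℝ) : V3 ⊗[ℝ] V3 :=
  (q ^ 3 + q) • (uB ⊗ₜ[ℝ] wB - wB ⊗ₜ[ℝ] uB) + (1 - q ^ 2) • (vB ⊗ₜ[ℝ] vB)

/-- The spin-1 generator `−q²v⊗w + w⊗v`. -/
def g3 (q : ℝ) : V3 ⊗[ℝ] V3 := (-(q ^ 2)) • (vB ⊗ₜ[ℝ] wB) + wB ⊗ₜ[ℝ] vB

/-- The trivial component `V₀`. -/
def V0s (q : ℝ) : Submodule ℝ (V3 ⊗[ℝ] V3) := Submodule.span ℝ {g0 q}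

/-- The spin-1 component `V₁`. -/
def V1s (q : ℝ) : Submodule ℝ (V3 ⊗[ℝ] V3) := Submodule.span ℝ {g1 q, g2 q, g3 q}

/-- The spin-2 component `V₂`. -/
def V2s (q : ℝ) : Submodule ℝ (V3 ⊗[ℝ] V3) :=
  Submodule.span ℝ
    {uB ⊗ₜ[ℝ] uB, uB ⊗ₜ[ℝ] vB + q ^ 2 • (vB ⊗ₜ[ℝ] uB),
     uB ⊗ₜ[ℝ] wB - q • (vB ⊗ₜ[ℝ] vB) + q ^ 4 • (wB ⊗ₜ[ℝ] uB),
     vB ⊗ₜ[ℝ] wB + q ^ 2 • (wB ⊗ₜ[ℝ] vB), wB ⊗ₜ[ℝ] wB}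

@[simp] lemma Xop_uB (q : ℝ) : Xop q uB = 0 := by
  ext i; fin_cases i <;> simp [Xop, uB, Matrix.mulVec, dotProduct, Fin.sum_univ_three]

@[simp] lemma Xop_vB (q : ℝ) : Xop q vB = (-(q + q⁻¹)) • uB := by
  ext i; fin_cases i <;> simp [Xop, uB, vB, Matrix.mulVec, dotProduct, Fin.sum_univ_three]

@[simp] lemma Xop_wB (q : ℝ) : Xop q wB = vB := by
  ext i; fin_cases i <;> simp [Xop, vB, wB, Matrix.mulVec, dotProduct, Fin.sum_univ_three]

@[simp] lemma Yop_uB (q : ℝ) : Yop q uB = -vB := by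
  ext i; fin_cases i <;> simp [Yop, uB, vB, Matrix.mulVec, dotProduct, Fin.sum_univ_three]

@[simp] lemma Yop_vB (q : ℝ) : Yop q vB = (q + q⁻¹) • wB := by
  ext i; fin_cases i <;> simp [Yop, vB, wB, Matrix.mulVec, dotProduct, Fin.sum_univ_three]

@[simp] lemma Yop_wB (q : ℝ) : Yop q wB = 0 := by
  ext i; fin_cases i <;> simp [Yop, wB, Matrix.mulVec, dotProduct, Fin.sum_univ_three]

@[simp] lemma Hop_uB : Hop uB = (2 : ℝ) • uB := by
  ext i; fin_cases i <;> simp [Hop, uB, Matrix.mulVec_diagonal]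

@[simp] lemma Hop_vB : Hop vB = 0 := by
  ext i; fin_cases i <;> simp [Hop, vB, Matrix.mulVec_diagonal]

@[simp] lemma Hop_wB : Hop wB = (-2 : ℝ) • wB := by
  ext i; fin_cases i <;> simp [Hop, wB, Matrix.mulVec_diagonal]

@[simp] lemma Kop_uB (q : ℝ) : Kop q uB = q ^ 2 • uB := by
  ext i; fin_cases i <;> simp [Kop, uB, Matrix.mulVec_diagonal]

@[simp] lemma Kop_vB (q : ℝ) : Kop q vB = vB := by
  ext i; fin_cases i <;> simp [Kop, vB, Matrix.mulVec_diagonal]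

@[simp] lemma Kop_wB (q : ℝ) : Kop q wB = (q ^ 2)⁻¹ • wB := by
  ext i; fin_cases i <;> simp [Kop, wB, Matrix.mulVec_diagonal]

@[simp] lemma Kinvop_uB (q : ℝ) : Kinvop q uB = (q ^ 2)⁻¹ • uB := by
  ext i; fin_cases i <;> simp [Kinvop, uB, Matrix.mulVec_diagonal]

@[simp] lemma Kinvop_vB (q : ℝ) : Kinvop q vB = vB := by
  ext i; fin_cases i <;> simp [Kinvop, vB, Matrix.mulVec_diagonal]

@[simp] lemma Kinvop_wB (q : ℝ) : Kinvop q wB = q ^ 2 • wB := by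
  ext i; fin_cases i <;> simp [Kinvop, wB, Matrix.mulVec_diagonal]

section Generators

variable {M : Type*} [AddCommGroup M] [Module ℝ M]

/-- A linear map on `V ⊗ V` is zero once it kills the nine products of basis vectors. -/
lemma eq_zero_of_basis_tmul {f : V3 ⊗[ℝ] V3 →ₗ[ℝ] M}
    (uu : f (uB ⊗ₜ uB) = 0) (uv : f (uB ⊗ₜ vB) = 0) (uw : f (uB ⊗ₜ wB) = 0)
    (vu : f (vB ⊗ₜ uB) = 0) (vv : f (vB ⊗ₜ vB) = 0) (vw : f (vB ⊗ₜ wB) = 0)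
    (wu : f (wB ⊗ₜ uB) = 0) (wv : f (wB ⊗ₜ vB) = 0) (ww : f (wB ⊗ₜ wB) = 0) : f = 0 := by
  have expand (x : V3) : x = x 0 • uB + x 1 • vB + x 2 • wB := by
    ext i; fin_cases i <;> simp [uB, vB, wB]
  refine TensorProduct.ext' fun x y => ?_
  rw [expand x, expand y]
  simp [add_tmul, tmul_add, ← smul_tmul', uu, uv, uw, vu, vv, vw, wu, wv, ww]

/-- If `x + q² y` and `q² x - y` both vanish, so do `x` and `y`. -/
lemma eq_zero_of_rotated_pair (q : ℝ) {x y : M} (hs : x + q ^ 2 • y = 0)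
    (ha : q ^ 2 • x - y = 0) : x = 0 ∧ y = 0 := by
  have hn : q ^ 4 + 1 ≠ 0 := by positivity
  constructor
  · refine (smul_eq_zero_iff_right hn).1 ?_
    linear_combination (norm := module) hs + q ^ 2 • ha
  · refine (smul_eq_zero_iff_right hn).1 ?_
    linear_combination (norm := module) q ^ 2 • hs - ha

/-- The weight-zero parts of `V₀`, `V₁` and `V₂` together span the weight-zero part of `V ⊗ V`. -/
lemma eq_zero_of_weight_zero {q : ℝ} (hq : q ≠ 0) {x y z : M}
    (h0 : (q ^ 3 + q) • x + y + (q + q⁻¹) • z = 0)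
    (h1 : (q ^ 3 + q) • (x - z) + (1 - q ^ 2) • y = 0)
    (h2 : x - q • y + q ^ 4 • z = 0) : x = 0 ∧ y = 0 ∧ z = 0 := by
  have n4 : q ^ 4 + 1 ≠ 0 := by positivity
  have n2 : q ^ 2 + 1 ≠ 0 := by positivity
  have n6 : q ^ 4 + q ^ 2 + 1 ≠ 0 := by positivity
  have e1 : y - (q ^ 3 + q) • z = 0 := by
    refine (smul_eq_zero_iff_right n4).1 ?_
    linear_combination (norm := module) h1 - (q ^ 3 + q) • h2
  have hz : z = 0 := by
    refine (smul_eq_zero_iff_right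
      (mul_ne_zero n6 (mul_ne_zero n2 (inv_ne_zero hq)))).1 ?_
    have key := congrArg₂ (· - ·) (congrArg₂ (· - ·) h0 (congrArg ((q ^ 3 + q) • ·) h2))
      (congrArg ((q ^ 4 + q ^ 2 + 1) • ·) e1)
    simp only [smul_zero, sub_zero] at key
    rw [← key]
    match_scalars <;> field_simp <;> ring
  have hy : y = 0 := by simpa [hz] using e1
  exact ⟨by simpa [hy, hz] using h2, hy, hz⟩

/-- The generators of `V₀`, `V₁` and `V₂` together span `V ⊗ V`. -/
lemma ext_on_generators {q : ℝ} (hq : q ≠ 0) {f g : V3 ⊗[ℝ] V3 →ₗ[ℝ] M}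
    (h0 : f (g0 q) = g (g0 q)) (h1 : f (g1 q) = g (g1 q)) (h2 : f (g2 q) = g (g2 q))
    (h3 : f (g3 q) = g (g3 q)) (hV2 : ∀ x ∈ V2s q, f x = g x) : f = g := by
  rw [← sub_eq_zero]
  have hs : ∀ x ∈ V2s q, (f - g) x = 0 := fun x hx => by simp [hV2 x hx]
  replace h0 : (f - g) (g0 q) = 0 := by simp [h0]
  replace h1 : (f - g) (g1 q) = 0 := by simp [h1]
  replace h2 : (f - g) (g2 q) = 0 := by simp [h2]
  replace h3 : (f - g) (g3 q) = 0 := by simp [h3]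
  generalize f - g = d at *
  have uu := hs (uB ⊗ₜ uB) (Submodule.subset_span (by simp))
  have s1 := hs (uB ⊗ₜ vB + q ^ 2 • (vB ⊗ₜ uB)) (Submodule.subset_span (by simp))
  have s2 := hs (uB ⊗ₜ wB - q • (vB ⊗ₜ vB) + q ^ 4 • (wB ⊗ₜ uB))
    (Submodule.subset_span (by simp))
  have s3 := hs (vB ⊗ₜ wB + q ^ 2 • (wB ⊗ₜ vB)) (Submodule.subset_span (by simp))
  have ww := hs (wB ⊗ₜ wB) (Submodule.subset_span (by simp))
  simp [g0, g1, g2, g3, map_add, map_sub, map_smul] at h0 h1 h2 h3 s1 s2 s3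
  obtain ⟨uv, vu⟩ := eq_zero_of_rotated_pair q s1 h1
  obtain ⟨vw, wv⟩ := eq_zero_of_rotated_pair q s3 (by rw [← neg_eq_zero, ← h3]; module)
  obtain ⟨uw, vv, wu⟩ := eq_zero_of_weight_zero hq h0 h2 s2
  exact eq_zero_of_basis_tmul uu uv uw vu vv vw wu wv ww

end Generators

@[simp] lemma X2_tmul (q : ℝ) (x y : V3) :
    X2 q (x ⊗ₜ y) = Xop q x ⊗ₜ y + Kinvop q x ⊗ₜ Xop q y := rfl

@[simp] lemma Y2_tmul (q : ℝ) (x y : V3) :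
    Y2 q (x ⊗ₜ y) = x ⊗ₜ Yop q y + Yop q x ⊗ₜ Kop q y := rfl

@[simp] lemma H2_tmul (x y : V3) : H2 (x ⊗ₜ y) = Hop x ⊗ₜ y + x ⊗ₜ Hop y := rfl

/-- `V₂` is invariant under an operator which maps each of its five generators into it. -/
lemma map_mem_V2s {q : ℝ} {T : V3 ⊗[ℝ] V3 →ₗ[ℝ] V3 ⊗[ℝ] V3}
    (h1 : T (uB ⊗ₜ uB) ∈ V2s q) (h2 : T (uB ⊗ₜ vB + q ^ 2 • (vB ⊗ₜ uB)) ∈ V2s q)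
    (h3 : T (uB ⊗ₜ wB - q • (vB ⊗ₜ vB) + q ^ 4 • (wB ⊗ₜ uB)) ∈ V2s q)
    (h4 : T (vB ⊗ₜ wB + q ^ 2 • (wB ⊗ₜ vB)) ∈ V2s q) (h5 : T (wB ⊗ₜ wB) ∈ V2s q) :
    ∀ x ∈ V2s q, T x ∈ V2s q := by
  refine (Submodule.span_le (p := (V2s q).comap T)).2 ?_
  rintro x (rfl | rfl | rfl | rfl | rfl) <;> assumption

section Action

set_option linter.unusedSimpArgs false
set_option linter.unnecessarySeqFocus false

lemma X2_mem_V2s {q : ℝ} (hq : q ≠ 0) : ∀ x ∈ V2s q, X2 q x ∈ V2s q := by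
  refine map_mem_V2s ?_ ?_ ?_ ?_ ?_
  · simp
  · have h : X2 q (uB ⊗ₜ vB + q ^ 2 • (vB ⊗ₜ uB)) =
        (-(q + q⁻¹) * (q ^ 2 + (q ^ 2)⁻¹) : ℝ) • (uB ⊗ₜ uB) := by
      simp [neg_tmul, tmul_neg, tmul_smul, ← smul_tmul']
      match_scalars <;> field_simp <;> ring
    exact h ▸ Submodule.smul_mem _ _ (Submodule.subset_span (by simp))
  · have h : X2 q (uB ⊗ₜ wB - q • (vB ⊗ₜ vB) + q ^ 4 • (wB ⊗ₜ uB)) =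
        (q ^ 2 + 1 + (q ^ 2)⁻¹ : ℝ) • (uB ⊗ₜ vB + q ^ 2 • (vB ⊗ₜ uB)) := by
      simp [neg_tmul, tmul_neg, tmul_smul, ← smul_tmul']
      match_scalars <;> field_simp <;> ring
    exact h ▸ Submodule.smul_mem _ _ (Submodule.subset_span (by simp))
  · have h : X2 q (vB ⊗ₜ wB + q ^ 2 • (wB ⊗ₜ vB)) =
        (-(q + q⁻¹) : ℝ) • (uB ⊗ₜ wB - q • (vB ⊗ₜ vB) + q ^ 4 • (wB ⊗ₜ uB)) := by
      simp [neg_tmul, tmul_neg, tmul_smul, ← smul_tmul']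
      match_scalars <;> field_simp <;> ring
    exact h ▸ Submodule.smul_mem _ _ (Submodule.subset_span (by simp))
  · have h : X2 q (wB ⊗ₜ wB) =
        vB ⊗ₜ wB + q ^ 2 • (wB ⊗ₜ vB) := by
      simp [← smul_tmul']
    exact h ▸ Submodule.subset_span (by simp)

lemma Y2_mem_V2s {q : ℝ} (hq : q ≠ 0) : ∀ x ∈ V2s q, Y2 q x ∈ V2s q := by
  refine map_mem_V2s ?_ ?_ ?_ ?_ ?_
  · have h : Y2 q (uB ⊗ₜ uB) =
        (-1 : ℝ) • (uB ⊗ₜ vB + q ^ 2 • (vB ⊗ₜ uB)) := by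
      simp [neg_tmul, tmul_neg, tmul_smul, ← smul_tmul']
    exact h ▸ Submodule.smul_mem _ _ (Submodule.subset_span (by simp))
  · have h : Y2 q (uB ⊗ₜ vB + q ^ 2 • (vB ⊗ₜ uB)) =
        (q + q⁻¹ : ℝ) • (uB ⊗ₜ wB - q • (vB ⊗ₜ vB) + q ^ 4 • (wB ⊗ₜ uB)) := by
      simp [neg_tmul, tmul_neg, tmul_smul, ← smul_tmul']
      match_scalars <;> field_simp <;> ring
    exact h ▸ Submodule.smul_mem _ _ (Submodule.subset_span (by simp))
  · have h : Y2 q (uB ⊗ₜ wB - q • (vB ⊗ₜ vB) + q ^ 4 • (wB ⊗ₜ uB)) =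
        (-(q ^ 2 + 1 + (q ^ 2)⁻¹) : ℝ) • (vB ⊗ₜ wB + q ^ 2 • (wB ⊗ₜ vB)) := by
      simp [neg_tmul, tmul_neg, tmul_smul, ← smul_tmul']
      match_scalars <;> field_simp <;> ring
    exact h ▸ Submodule.smul_mem _ _ (Submodule.subset_span (by simp))
  · have h : Y2 q (vB ⊗ₜ wB + q ^ 2 • (wB ⊗ₜ vB)) =
        ((q + q⁻¹) * (q ^ 2 + (q ^ 2)⁻¹) : ℝ) • (wB ⊗ₜ wB) := by
      simp [neg_tmul, tmul_neg, tmul_smul, ← smul_tmul']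
      match_scalars <;> field_simp <;> ring
    exact h ▸ Submodule.smul_mem _ _ (Submodule.subset_span (by simp))
  · simp

lemma H2_mem_V2s (q : ℝ) : ∀ x ∈ V2s q, H2 x ∈ V2s q := by
  refine map_mem_V2s ?_ ?_ ?_ ?_ ?_
  · have h : H2 (uB ⊗ₜ uB) = (4 : ℝ) • (uB ⊗ₜ uB) := by
      simp [neg_tmul, tmul_neg, tmul_smul, ← smul_tmul']
      module
    exact h ▸ Submodule.smul_mem _ _ (Submodule.subset_span (by simp))
  · have h : H2 (uB ⊗ₜ vB + q ^ 2 • (vB ⊗ₜ uB)) =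
        (2 : ℝ) • (uB ⊗ₜ vB + q ^ 2 • (vB ⊗ₜ uB)) := by
      simp [neg_tmul, tmul_neg, tmul_smul, ← smul_tmul']
      module
    exact h ▸ Submodule.smul_mem _ _ (Submodule.subset_span (by simp))
  · have h : H2 (uB ⊗ₜ wB - q • (vB ⊗ₜ vB) + q ^ 4 • (wB ⊗ₜ uB)) =
        (0 : ℝ) • (uB ⊗ₜ wB - q • (vB ⊗ₜ vB) + q ^ 4 • (wB ⊗ₜ uB)) := by
      simp [neg_tmul, tmul_neg, tmul_smul, ← smul_tmul']
    exact h ▸ Submodule.smul_mem _ _ (Submodule.subset_span (by simp))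
  · have h : H2 (vB ⊗ₜ wB + q ^ 2 • (wB ⊗ₜ vB)) =
        (-2 : ℝ) • (vB ⊗ₜ wB + q ^ 2 • (wB ⊗ₜ vB)) := by
      simp [neg_tmul, tmul_neg, tmul_smul, ← smul_tmul']
      module
    exact h ▸ Submodule.smul_mem _ _ (Submodule.subset_span (by simp))
  · have h : H2 (wB ⊗ₜ wB) = (-4 : ℝ) • (wB ⊗ₜ wB) := by
      simp [neg_tmul, tmul_neg, tmul_smul, ← smul_tmul']
      module
    exact h ▸ Submodule.smul_mem _ _ (Submodule.subset_span (by simp))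

lemma X2_g0 {q : ℝ} (hq : q ≠ 0) : X2 q (g0 q) = 0 := by
  simp [g0, neg_tmul, tmul_neg, tmul_smul, ← smul_tmul']
  match_scalars <;> field_simp <;> ring

lemma X2_g1 {q : ℝ} (hq : q ≠ 0) : X2 q (g1 q) = 0 := by
  simp [g1, neg_tmul, tmul_neg, tmul_smul, ← smul_tmul']
  match_scalars; field_simp; ring

lemma X2_g2 {q : ℝ} (hq : q ≠ 0) : X2 q (g2 q) = (q + q⁻¹ : ℝ) • g1 q := by
  simp [g2, g1, neg_tmul, tmul_neg, tmul_smul, ← smul_tmul']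
  match_scalars <;> field_simp <;> ring

lemma X2_g3 {q : ℝ} (hq : q ≠ 0) : X2 q (g3 q) = g2 q := by
  simp [g3, g2, neg_tmul, tmul_neg, tmul_smul, ← smul_tmul']
  match_scalars <;> field_simp <;> ring

lemma Y2_g0 {q : ℝ} (hq : q ≠ 0) : Y2 q (g0 q) = 0 := by
  simp [g0, neg_tmul, tmul_neg, tmul_smul, ← smul_tmul']
  match_scalars <;> field_simp <;> ring

lemma Y2_g1 {q : ℝ} (hq : q ≠ 0) : Y2 q (g1 q) = g2 q := by
  simp [g1, g2, neg_tmul, tmul_neg, tmul_smul, ← smul_tmul']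
  match_scalars <;> field_simp; ring

lemma Y2_g2 {q : ℝ} (hq : q ≠ 0) : Y2 q (g2 q) = (q + q⁻¹ : ℝ) • g3 q := by
  simp [g2, g3, neg_tmul, tmul_neg, tmul_smul, ← smul_tmul']
  match_scalars <;> field_simp <;> ring

lemma Y2_g3 {q : ℝ} (hq : q ≠ 0) : Y2 q (g3 q) = 0 := by
  simp [g3, neg_tmul, tmul_neg, tmul_smul, ← smul_tmul']
  match_scalars; field_simp; ring

lemma H2_g0 (q : ℝ) : H2 (g0 q) = 0 := by
  simp [g0, neg_tmul, tmul_neg, tmul_smul, ← smul_tmul']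

lemma H2_g1 (q : ℝ) : H2 (g1 q) = (2 : ℝ) • g1 q := by
  simp [g1, neg_tmul, tmul_neg, tmul_smul, ← smul_tmul']
  module

lemma H2_g2 (q : ℝ) : H2 (g2 q) = 0 := by
  simp [g2, neg_tmul, tmul_neg, tmul_smul, ← smul_tmul']

lemma H2_g3 (q : ℝ) : H2 (g3 q) = (-2 : ℝ) • g3 q := by
  simp [g3, neg_tmul, tmul_neg, tmul_smul, ← smul_tmul']
  module

end Action

/-- A linear map to `V ⊕ k` intertwines `T` with `S ⊕ 0` if it kills `V₂`, `T` preserves `V₂`, and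
the relation holds on the generators of `V₀` and `V₁`. -/
lemma intertwines_of_generators {q : ℝ} (hq : q ≠ 0) {φ : V3 ⊗[ℝ] V3 →ₗ[ℝ] V3 × ℝ}
    (hV2 : ∀ x ∈ V2s q, φ x = 0) {T : V3 ⊗[ℝ] V3 →ₗ[ℝ] V3 ⊗[ℝ] V3} {S : V3 →ₗ[ℝ] V3}
    (hT : ∀ x ∈ V2s q, T x ∈ V2s q)
    (h0 : φ (T (g0 q)) = (S (φ (g0 q)).1, 0)) (h1 : φ (T (g1 q)) = (S (φ (g1 q)).1, 0))
    (h2 : φ (T (g2 q)) = (S (φ (g2 q)).1, 0)) (h3 : φ (T (g3 q)) = (S (φ (g3 q)).1, 0))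
    (x : V3 ⊗[ℝ] V3) : φ (T x) = (S (φ x).1, 0) := by
  have h : φ ∘ₗ T = LinearMap.inl ℝ V3 ℝ ∘ₗ S ∘ₗ LinearMap.fst ℝ V3 ℝ ∘ₗ φ :=
    ext_on_generators hq h0 h1 h2 h3 fun x hx => by
      simp [hV2 x hx, hV2 _ (hT x hx), Prod.ext_iff]
  exact LinearMap.congr_fun h x

/-- the linear map `φ : V⊗V → V ⊕ k` vanishing on `V₂` and taking the
prescribed values on the generators of `V₁` and `V₀` intertwines the `U_q(sl(2))`-actions
(where `X, Y, H` act on `V ⊕ k` by `X̂, Ŷ, Ĥ` on the `V`-summand and by zero on `k`). -/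
theorem defining_map_intertwines (q h c : ℝ) (hq : q ≠ 0)
    (φ : V3 ⊗[ℝ] V3 →ₗ[ℝ] V3 × ℝ)
    (hV2 : ∀ x ∈ V2s q, φ x = 0)
    (hg1 : φ (g1 q) = ((-(2 * h)) • uB, 0))
    (hg2 : φ (g2 q) = ((2 * h) • vB, 0))
    (hg3 : φ (g3 q) = ((2 * h) • wB, 0))
    (hg0 : φ (g0 q) = (0, c)) :
    (∀ x : V3 ⊗[ℝ] V3, φ (X2 q x) = (Xop q (φ x).1, 0)) ∧
    (∀ x : V3 ⊗[ℝ] V3, φ (Y2 q x) = (Yop q (φ x).1, 0)) ∧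
    (∀ x : V3 ⊗[ℝ] V3, φ (H2 x) = (Hop (φ x).1, 0)) := by
  refine ⟨?_, ?_, ?_⟩
  · refine intertwines_of_generators hq hV2 (X2_mem_V2s hq) ?_ ?_ ?_ ?_
    · simp [X2_g0 hq, hg0, Prod.ext_iff]
    · simp [X2_g1 hq, hg1, Prod.ext_iff]
    · simp only [X2_g2 hq, hg2, hg1, map_smul, Xop_vB, Prod.smul_mk, smul_zero]
      congr 1
      module
    · simp [X2_g3 hq, hg3, hg2, mul_comm]
  · refine intertwines_of_generators hq hV2 (Y2_mem_V2s hq) ?_ ?_ ?_ ?_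
    · simp [Y2_g0 hq, hg0, Prod.ext_iff]
    · simp [Y2_g1 hq, hg1, hg2, mul_comm]
    · simp [Y2_g2 hq, hg2, hg3, smul_smul, mul_comm]
    · simp [Y2_g3 hq, hg3, Prod.ext_iff]
  · refine intertwines_of_generators hq hV2 (H2_mem_V2s q) ?_ ?_ ?_ ?_
    · simp [H2_g0 q, hg0, Prod.ext_iff]
    · simp [H2_g1 q, hg1, smul_smul, mul_comm]
    · simp [H2_g2 q, hg2, Prod.ext_iff]
    · simp [H2_g3 q, hg3, smul_smul, mul_comm]
end
end
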